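/- For all real ν ≥ -1 and all x > 0, I_ν(x)·K_ν(x) > 1/(1 + √(ν² + x²) + √((ν−1)² + x²)). -/

import Mathlib

open Real

/-- Modified Bessel function of the first kind `I_ν(x)` (for `x > 0`),
defined by its standard power series. -/
noncomputable def besselI (ν x : ℝ) : ℝ :=
  ∑' k : ℕ, (x / 2) ^ (2 * k) / ((Nat.factorial k : ℝ) * Real.Gamma (k + ν + 1)) * (x / 2) ^ ν

/-- Modified Bessel function of the second kind `K_ν(x)` (for `x > 0`),
defined by its standard integral representation. -/
noncomputable def besselK (ν x : ℝ) : ℝ :=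
  ∫ t in Set.Ioi (0 : ℝ), Real.exp (-x * Real.cosh t) * Real.cosh (ν * t)
open MeasureTheory Filter Topology

noncomputable def Gf (ν z : ℝ) : ℝ := ∑' k : ℕ, z ^ k / ((Nat.factorial k : ℝ) * Real.Gamma (k + ν + 1))

noncomputable def Lf (a z : ℝ) : ℝ := ∫ t : ℝ, Real.exp (a * t - Real.exp t - z * Real.exp (-t))

lemma gamma_pos (ν : ℝ) (hν : -1 < ν) (k : ℕ) : 0 < Real.Gamma (k + ν + 1) := by
  apply Real.Gamma_pos_of_pos
  have : (0:ℝ) ≤ k := k.cast_nonneg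
  linarith

lemma inv_gamma_bound (ν : ℝ) (hν : -1 < ν) : ∃ C, 0 < C ∧ ∀ k : ℕ, 1 / Real.Gamma (k + ν + 1) ≤ C := by
  have h0 := gamma_pos ν hν 0
  have h1 := gamma_pos ν hν 1
  have e0 := one_div_pos.2 h0
  have e1 := one_div_pos.2 h1
  refine ⟨1 / Real.Gamma ((0:ℕ) + ν + 1) + 1 / Real.Gamma ((1:ℕ) + ν + 1) + 1, by positivity, ?_⟩
  intro k
  match k with
  | 0 => linarith
  | 1 => linarith
  | (k+2) =>
    have hk : (0:ℝ) ≤ k := k.cast_nonneg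
    have : Real.Gamma 2 ≤ Real.Gamma ((k+2 : ℕ) + ν + 1) := by
      apply Real.Gamma_strictMonoOn_Ici.monotoneOn
      · simp
      · simp; linarith
      · push_cast; linarith
    rw [Real.Gamma_two] at this
    have : 1 / Real.Gamma ((k+2 : ℕ) + ν + 1) ≤ 1 := by
      rw [div_le_one (gamma_pos ν hν _)]; exact this
    linarith

lemma Gf_summable (ν : ℝ) (hν : -1 < ν) (z : ℝ) :
    Summable fun k : ℕ => z ^ k / ((Nat.factorial k : ℝ) * Real.Gamma (k + ν + 1)) := by
  obtain ⟨C, hC, h⟩ := inv_gamma_bound ν hν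
  refine Summable.of_norm_bounded (g := fun k : ℕ => (|z| ^ k / (Nat.factorial k : ℝ)) * C)
    ((Real.summable_pow_div_factorial |z|).mul_right C) ?_
  intro k
  have hg := gamma_pos ν hν k
  rw [norm_div, norm_pow, Real.norm_eq_abs, Real.norm_of_nonneg (by positivity), ← div_div, div_eq_mul_one_div (_ / _)]
  exact mul_le_mul_of_nonneg_left (h k) (by positivity)

lemma Gf_deriv (ν : ℝ) (hν : -1 < ν) (z : ℝ) : HasDerivAt (Gf ν) (Gf (ν + 1) z) z := by
  set R := |z| + 1 with hR
  have hR0 : 0 < R := by positivity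
  have key : ∀ k : ℕ, ∀ y : ℝ, ((k+1:ℕ):ℝ) * y ^ k / ((Nat.factorial (k+1) : ℝ) * Real.Gamma ((k+1:ℕ) + ν + 1))
      = y ^ k / ((Nat.factorial k : ℝ) * Real.Gamma (k + (ν + 1) + 1)) := by
    intro k y
    rw [Nat.factorial_succ]
    push_cast
    rw [show (k:ℝ) + 1 + ν + 1 = k + (ν + 1) + 1 by ring]
    have := (gamma_pos (ν+1) (by linarith) k).ne'
    field_simp
  have h := hasDerivAt_tsum_of_isPreconnected (𝕜 := ℝ) (F := ℝ)
    (g := fun (k : ℕ) z => z ^ k / ((Nat.factorial k : ℝ) * Real.Gamma (k + ν + 1)))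
    (g' := fun (k : ℕ) z => (k : ℝ) * z ^ (k-1) / ((Nat.factorial k : ℝ) * Real.Gamma (k + ν + 1)))
    (u := fun (k : ℕ) => (k : ℝ) * R ^ (k-1) / ((Nat.factorial k : ℝ) * Real.Gamma (k + ν + 1)))
    (t := Metric.ball 0 R) (y₀ := z) (y := z) ?_ Metric.isOpen_ball
      (convex_ball _ _).isPreconnected ?_ ?_ ?_ ?_ ?_
  · refine HasDerivAt.congr_deriv (f := Gf ν) h ?_
    rw [Gf, Summable.tsum_eq_zero_add]
    · simp only [Nat.add_sub_cancel, key]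
      simp
    · rw [← summable_nat_add_iff 1]
      simp only [Nat.add_sub_cancel, key]
      exact Gf_summable (ν+1) (by linarith) z
  · rw [← summable_nat_add_iff 1]
    simp only [Nat.add_sub_cancel, key]
    exact Gf_summable (ν+1) (by linarith) R
  · intro n y hy
    exact (hasDerivAt_pow n y).div_const _
  · intro n y hy
    have hg := gamma_pos ν hν n
    rw [norm_div, norm_mul, norm_pow, Real.norm_of_nonneg (by positivity : (0:ℝ) ≤ n), Real.norm_of_nonneg (by positivity : 0 ≤ (Nat.factorial n : ℝ) * Real.Gamma (n + ν + 1))]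
    have : ‖y‖ ≤ R := by simpa using (mem_ball_zero_iff.1 hy).le
    gcongr
  · simp [hR]
  · exact Gf_summable ν hν z
  · simp [hR]

lemma Gf_rec (ν : ℝ) (hν : -1 < ν) (z : ℝ) :
    z * Gf (ν + 2) z + (ν + 1) * Gf (ν + 1) z = Gf ν z := by
  have s0 := Gf_summable ν hν z
  have s1 := (Gf_summable (ν+1) (by linarith) z).mul_left (ν+1)
  have s2 := (Gf_summable (ν+2) (by linarith) z).mul_left z
  have e1 : (ν + 1) * Gf (ν + 1) z = _ := (tsum_mul_left (a := ν + 1) ).symm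
  have e2 : z * Gf (ν + 2) z = _ := (tsum_mul_left (a := z) ).symm
  rw [e1, e2, Gf, s0.tsum_eq_zero_add, s1.tsum_eq_zero_add]
  rw [add_left_comm, ← s2.tsum_add ((summable_nat_add_iff 1).2 s1)]
  congr 1
  · have := Real.Gamma_add_one (s := ν + 1) (by linarith)
    have h2 := (gamma_pos ν hν 0).ne'
    simp only [Nat.cast_zero, zero_add] at h2
    simp only [Nat.cast_zero, zero_add, this]
    have h3 : ν + 1 ≠ 0 := by linarith
    simp
    field_simp
  · congr 1
    ext k
    have hk : (0:ℝ) ≤ k := k.cast_nonneg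
    have h3 : (k:ℝ) + ν + 2 ≠ 0 := by linarith
    have := Real.Gamma_add_one (s := k + ν + 2) h3
    have h2 := (gamma_pos ν hν (k+1)).ne'
    push_cast at h2 ⊢
    rw [show (k:ℝ) + (ν + 2) + 1 = k + ν + 2 + 1 by ring, show (k:ℝ) + 1 + (ν + 1) + 1 = k + ν + 2 + 1 by ring, this]
    rw [show (k:ℝ) + 1 + ν + 1 = k + ν + 2 by ring] at h2 ⊢
    rw [Nat.factorial_succ]
    push_cast
    field_simp
    ring

lemma Gf_pos (ν : ℝ) (hν : -1 < ν) (z : ℝ) (hz : 0 ≤ z) : 0 < Gf ν z := by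
  refine (Gf_summable ν hν z).tsum_pos (fun k => ?_) 0 ?_
  · have hg := gamma_pos ν hν k
    positivity
  · have hg := gamma_pos ν hν 0
    simp at hg ⊢
    exact hg

lemma Gf_zero (ν : ℝ) : Gf ν 0 = 1 / Real.Gamma (ν + 1) := by
  rw [Gf, tsum_eq_single 0]
  · simp
  · intro k hk; simp [hk]

lemma Gf_cont (ν : ℝ) (hν : -1 < ν) : Continuous (Gf ν) :=
  continuous_iff_continuousAt.2 fun z => (Gf_deriv ν hν z).continuousAt

/-- Turan-type inequality. -/
lemma Gf_turan (ν : ℝ) (hν : -1 < ν) (z : ℝ) (hz : 0 < z) :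
    0 < Gf ν z ^ 2 - ν * Gf ν z * Gf (ν+1) z - z * Gf (ν+1) z ^ 2 := by
  set H : ℝ → ℝ := fun z => z ^ (ν + 1) * (Gf ν z ^ 2 - ν * Gf ν z * Gf (ν+1) z - z * Gf (ν+1) z ^ 2) with hH
  have hd : ∀ y, 0 < y → HasDerivAt H (y ^ ν * Gf ν y ^ 2) y := by
    intro y hy
    have d0 := Gf_deriv ν hν y
    have d1 := Gf_deriv (ν+1) (by linarith) y
    have r := Gf_rec ν hν y
    have dp : HasDerivAt (fun y : ℝ => y ^ (ν+1)) ((ν+1) * y ^ (ν + 1 - 1)) y :=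
      Real.hasDerivAt_rpow_const (Or.inl hy.ne')
    have := dp.mul (((d0.pow 2).sub ((d0.const_mul ν).mul d1)).sub ((hasDerivAt_id y).mul (d1.pow 2)))
    refine HasDerivAt.congr_deriv (f := H) this ?_
    rw [show ν + 1 - 1 = ν by ring, Real.rpow_add_one hy.ne', show ν + 1 + 1 = ν + 2 by ring]
    simp
    generalize y ^ ν = P
    rw [← r]
    ring
  have hc : ContinuousOn H (Set.Ici 0) := by
    have c0 := Gf_cont ν hν
    have c1 := Gf_cont (ν+1) (by linarith)
    have : Continuous fun y : ℝ => y ^ (ν+1) := Real.continuous_rpow_const (by linarith)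
    apply Continuous.continuousOn
    fun_prop
  have hm : StrictMonoOn H (Set.Ici 0) := by
    apply strictMonoOn_of_deriv_pos (convex_Ici 0) hc
    intro y hy
    rw [interior_Ici] at hy
    have hy : 0 < y := hy
    rw [(hd y hy).deriv]
    have := Gf_pos ν hν y hy.le
    positivity
  have := hm (Set.self_mem_Ici) (hz.le : z ∈ Set.Ici 0) hz
  have h0 : H 0 = 0 := by simp [hH, Real.zero_rpow (by linarith : ν + 1 ≠ 0)]
  rw [h0] at this
  exact pos_of_mul_pos_right this (by positivity)

lemma exp_image : Real.exp '' Set.univ = Set.Ioi 0 := by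
  rw [Set.image_univ, Real.range_exp]

lemma gamma_exp_integrable (a : ℝ) (ha : 0 < a) :
    Integrable fun t : ℝ => Real.exp (a * t - Real.exp t) := by
  have h := (integrableOn_image_iff_integrableOn_abs_deriv_smul MeasurableSet.univ
    (fun x _ => (Real.hasDerivAt_exp x).hasDerivWithinAt) (Real.exp_injective.injOn)
    (fun x : ℝ => Real.exp (-x) * x ^ (a - 1))).1 (by
      rw [exp_image]; exact Real.GammaIntegral_convergent ha)
  rw [integrableOn_univ] at h
  refine h.congr (ae_of_all _ fun t => ?_)
  simp only [smul_eq_mul, abs_of_pos (Real.exp_pos t)]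
  rw [← Real.exp_mul, ← Real.exp_add, ← Real.exp_add]
  congr 1; ring

lemma gamma_exp_integral (a : ℝ) (ha : 0 < a) :
    ∫ t : ℝ, Real.exp (a * t - Real.exp t) = Real.Gamma a := by
  have h := integral_image_eq_integral_abs_deriv_smul MeasurableSet.univ
    (fun x _ => (Real.hasDerivAt_exp x).hasDerivWithinAt) (Real.exp_injective.injOn)
    (fun x : ℝ => Real.exp (-x) * x ^ (a - 1))
  rw [exp_image, ← Real.Gamma_eq_integral ha, setIntegral_univ] at h
  rw [h]
  congr 1
  ext t
  simp only [smul_eq_mul, abs_of_pos (Real.exp_pos t)]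
  rw [← Real.exp_mul, ← Real.exp_add, ← Real.exp_add]
  congr 1; ring

lemma Lf_integrable (a z : ℝ) (hz : 0 < z) :
    Integrable fun t : ℝ => Real.exp (a * t - Real.exp t - z * Real.exp (-t)) := by
  obtain ⟨n, hn⟩ := exists_nat_gt (-a)
  refine ((gamma_exp_integrable (a + n) (by linarith)).const_mul (Nat.factorial n / z ^ n)).mono'
    (by fun_prop) (ae_of_all _ fun t => ?_)
  rw [Real.norm_of_nonneg (Real.exp_pos _).le]
  have h := Real.pow_div_factorial_le_exp (x := z * Real.exp (-t)) (by positivity) n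
  rw [Real.exp_sub _ (z * _), div_le_iff₀ (Real.exp_pos _)]
  calc Real.exp (a * t - Real.exp t) = Nat.factorial n / z ^ n * Real.exp ((a + n) * t - Real.exp t) * ((z * Real.exp (-t)) ^ n / Nat.factorial n) := by
        rw [mul_pow, ← Real.exp_nat_mul]
        have : Real.exp ((a + n) * t - Real.exp t) * Real.exp (n * -t) = Real.exp (a * t - Real.exp t) := by
          rw [← Real.exp_add]; congr 1; ring
        rw [← this]
        have := Nat.factorial_ne_zero n
        field_simp
    _ ≤ _ := by gcongr

lemma Lf_pos (a z : ℝ) (hz : 0 < z) : 0 < Lf a z :=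
  integral_exp_pos (Lf_integrable a z hz)

lemma Lf_deriv (a z : ℝ) (hz : 0 < z) : HasDerivAt (Lf a) (-Lf (a - 1) z) z := by
  have h := (hasDerivAt_integral_of_dominated_loc_of_deriv_le (μ := volume) (𝕜 := ℝ) (x₀ := z)
    (F := fun z t => Real.exp (a * t - Real.exp t - z * Real.exp (-t)))
    (F' := fun z t => -Real.exp ((a - 1) * t - Real.exp t - z * Real.exp (-t)))
    (s := Set.Ioi (z / 2))
    (bound := fun t => Real.exp ((a - 1) * t - Real.exp t - (z / 2) * Real.exp (-t)))
    (Ioi_mem_nhds (by linarith)) (Eventually.of_forall fun y => by fun_prop)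
    (Lf_integrable a z hz) (by fun_prop) ?_ (Lf_integrable (a - 1) (z / 2) (by linarith)) ?_).2
  · rw [integral_neg] at h
    exact h
  · refine ae_of_all _ fun t y hy => ?_
    have hy : z / 2 < y := hy
    rw [norm_neg, Real.norm_of_nonneg (Real.exp_pos _).le]
    gcongr
  · refine ae_of_all _ fun t y hy => ?_
    have : HasDerivAt (fun y => a * t - Real.exp t - y * Real.exp (-t)) (-(1 * Real.exp (-t))) y :=
      ((hasDerivAt_id y).mul_const _).const_sub _
    refine this.exp.congr_deriv ?_
    rw [one_mul, mul_neg, ← Real.exp_add]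
    congr 2; ring

lemma Lf_rec (a z : ℝ) (hz : 0 < z) : z * Lf (a - 1) z = Lf (a + 1) z - a * Lf a z := by
  have i0 := (Lf_integrable a z hz).const_mul a
  have i1 := Lf_integrable (a + 1) z hz
  have i2 := (Lf_integrable (a - 1) z hz).const_mul z
  have h := integral_eq_zero_of_hasDerivAt_of_integrable
    (f := fun t => Real.exp (a * t - Real.exp t - z * Real.exp (-t)))
    (f' := fun t => (a * Real.exp (a * t - Real.exp t - z * Real.exp (-t))
      - Real.exp ((a + 1) * t - Real.exp t - z * Real.exp (-t)))
      + z * Real.exp ((a - 1) * t - Real.exp t - z * Real.exp (-t))) ?_ ((i0.sub i1).add i2)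
      (Lf_integrable a z hz)
  · have j := integral_add (i0.sub i1) i2
    simp only [Pi.sub_apply] at j
    rw [j, integral_sub i0 i1, integral_const_mul, integral_const_mul] at h
    change a * Lf a z - Lf (a + 1) z + z * Lf (a - 1) z = 0 at h
    linarith
  · intro t
    have d1 : HasDerivAt (fun t => a * t - Real.exp t - z * Real.exp (-t))
        (a * 1 - Real.exp t - z * (Real.exp (-t) * -1)) t :=
      (((hasDerivAt_id t).const_mul a).sub (Real.hasDerivAt_exp t)).sub
        ((hasDerivAt_neg t).exp.const_mul z)
    refine d1.exp.congr_deriv ?_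
    have e1 : Real.exp ((a + 1) * t - Real.exp t - z * Real.exp (-t)) =
        Real.exp (a * t - Real.exp t - z * Real.exp (-t)) * Real.exp t := by
      rw [← Real.exp_add]; congr 1; ring
    have e2 : Real.exp ((a - 1) * t - Real.exp t - z * Real.exp (-t)) =
        Real.exp (a * t - Real.exp t - z * Real.exp (-t)) * Real.exp (-t) := by
      rw [← Real.exp_add]; congr 1; ring
    rw [e1, e2]; ring

lemma Lf_quad (a z : ℝ) (hz : 0 < z) (b c : ℝ) :
    0 ≤ b ^ 2 * Lf (a - 1) z + 2 * b * c * Lf a z + c ^ 2 * Lf (a + 1) z := by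
  have i0 := (Lf_integrable a z hz).const_mul (2 * b * c)
  have i1 := (Lf_integrable (a + 1) z hz).const_mul (c ^ 2)
  have i2 := (Lf_integrable (a - 1) z hz).const_mul (b ^ 2)
  unfold Lf
  rw [← integral_const_mul, ← integral_const_mul, ← integral_const_mul, ← integral_add i2 i0]
  have j := integral_add (i2.add i0) i1
  simp only [Pi.add_apply] at j
  rw [← j]
  apply integral_nonneg
  intro t
  have e1 : Real.exp ((a + 1) * t - Real.exp t - z * Real.exp (-t)) =
      Real.exp ((a - 1) * t - Real.exp t - z * Real.exp (-t)) * (Real.exp t) ^ 2 := by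
    rw [pow_two, ← Real.exp_add, ← Real.exp_add]; congr 1; ring
  have e2 : Real.exp (a * t - Real.exp t - z * Real.exp (-t)) =
      Real.exp ((a - 1) * t - Real.exp t - z * Real.exp (-t)) * Real.exp t := by
    rw [← Real.exp_add]; congr 1; ring
  simp only [e1, e2, Pi.zero_apply]
  have := mul_nonneg (Real.exp_pos ((a - 1) * t - Real.exp t - z * Real.exp (-t))).le (sq_nonneg (b + c * Real.exp t))
  nlinarith [this]

lemma Lf_turan (a z : ℝ) (hz : 0 < z) : Lf a z ^ 2 ≤ Lf (a - 1) z * Lf (a + 1) z := by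
  have h := Lf_quad a z hz (Lf (a + 1) z) (- Lf a z)
  have hp := Lf_pos (a + 1) z hz
  have : 0 ≤ Lf (a + 1) z * (Lf (a - 1) z * Lf (a + 1) z - Lf a z ^ 2) := by nlinarith [h]
  have := nonneg_of_mul_nonneg_right this hp
  linarith

lemma Lf_tendsto (a : ℝ) (ha : 0 < a) : Tendsto (Lf a) (𝓝[>] 0) (𝓝 (Real.Gamma a)) := by
  rw [← gamma_exp_integral a ha]
  refine tendsto_integral_filter_of_dominated_convergence
    (fun t => Real.exp (a * t - Real.exp t)) (Eventually.of_forall fun y => by fun_prop) ?_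
    (gamma_exp_integrable a ha) ?_
  · filter_upwards [self_mem_nhdsWithin] with y hy
    have hy : 0 < y := hy
    refine ae_of_all _ fun t => ?_
    rw [Real.norm_of_nonneg (Real.exp_pos _).le]
    have := mul_pos hy (Real.exp_pos (-t))
    exact Real.exp_le_exp.2 (by linarith)
  · refine ae_of_all _ fun t => ?_
    have : Continuous fun y : ℝ => Real.exp (a * t - Real.exp t - y * Real.exp (-t)) := by fun_prop
    have := (this.tendsto 0).mono_left (nhdsWithin_le_nhds (s := Set.Ioi 0))
    simpa using this

lemma wronskian (ν : ℝ) (hν : -1 < ν) (z : ℝ) (hz : 0 < z) :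
    Gf ν z * Lf (ν + 1) z + z * Gf (ν + 1) z * Lf ν z = 1 := by
  set W : ℝ → ℝ := fun z => Gf ν z * Lf (ν + 1) z + z * Gf (ν + 1) z * Lf ν z with hW
  have hd : ∀ y ∈ Set.Ioi (0:ℝ), HasDerivAt W 0 y := by
    intro y hy
    have hy : 0 < y := hy
    have d0 := Gf_deriv ν hν y
    have d1 := Gf_deriv (ν+1) (by linarith) y
    have l0 := Lf_deriv ν y hy
    have l1 := Lf_deriv (ν+1) y hy
    have r := Gf_rec ν hν y
    have r' := Lf_rec ν y hy
    have := (d0.mul l1).add (((hasDerivAt_id y).mul d1).mul l0)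
    refine HasDerivAt.congr_deriv (f := W) this ?_
    rw [show ν + 1 + 1 = ν + 2 by ring, show ν + 1 - 1 = ν by ring]
    simp
    linear_combination Lf ν y * r - Gf (ν+1) y * r'
  have hconst : ∀ y ∈ Set.Ioi (0:ℝ), W y = W z := by
    intro y hy
    refine isOpen_Ioi.is_const_of_deriv_eq_zero isPreconnected_Ioi ?_ ?_ hy hz
    · intro y hy; exact (hd y hy).differentiableAt.differentiableWithinAt
    · intro y hy; exact (hd y hy).deriv
  have t1 : Tendsto W (𝓝[>] 0) (𝓝 (W z)) := by
    refine tendsto_const_nhds.congr' ?_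
    filter_upwards [self_mem_nhdsWithin] with y hy using (hconst y hy).symm
  have t2 : Tendsto W (𝓝[>] 0) (𝓝 (Gf ν 0 * Real.Gamma (ν + 1) + Gf (ν + 1) 0 * (Real.Gamma (ν + 2) - (ν + 1) * Real.Gamma (ν + 1)))) := by
    have g0 := ((Gf_cont ν hν).tendsto 0).mono_left (nhdsWithin_le_nhds (s := Set.Ioi 0))
    have g1 := ((Gf_cont (ν + 1) (by linarith)).tendsto 0).mono_left (nhdsWithin_le_nhds (s := Set.Ioi 0))
    have l1 := Lf_tendsto (ν + 1) (by linarith)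
    have l2 := Lf_tendsto (ν + 2) (by linarith)
    refine ((g0.mul l1).add (g1.mul (l2.sub (l1.const_mul (ν + 1))))).congr' ?_
    filter_upwards [self_mem_nhdsWithin] with y hy
    have r := Lf_rec (ν + 1) y hy
    rw [show ν + 1 + 1 = ν + 2 by ring, show ν + 1 - 1 = ν by ring] at r
    simp only [hW]
    rw [← r]; ring
  have := tendsto_nhds_unique t1 t2
  rw [Gf_zero, show ν + 2 = ν + 1 + 1 by ring, Real.Gamma_add_one (s := ν + 1) (by linarith)] at this
  have hg := (Real.Gamma_pos_of_pos (s := ν + 1) (by linarith)).ne'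
  rw [sub_self, mul_zero, add_zero, one_div, inv_mul_cancel₀ hg] at this
  exact this

lemma besselI_eq (ν x : ℝ) : besselI ν x = Gf ν (x ^ 2 / 4) * (x / 2) ^ ν := by
  rw [besselI, Gf, ← tsum_mul_right]
  congr 1; ext k
  rw [pow_mul]; congr 3; ring

lemma besselK_eq (ν x : ℝ) (hx : 0 < x) : besselK ν x = (x / 2) ^ (-ν) / 2 * Lf ν (x ^ 2 / 4) := by
  have hx2 : 0 < x / 2 := by positivity
  set c := Real.log (x / 2) with hc
  have ec : Real.exp c = x / 2 := Real.exp_log hx2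
  set F : ℝ → ℝ := fun t => Real.exp (ν * t - Real.exp t - x ^ 2 / 4 * Real.exp (-t)) with hF
  have hFi : Integrable F := Lf_integrable ν _ (by positivity)
  set f : ℝ → ℝ := fun t => Real.exp (ν * t - x * Real.cosh t) with hf
  have e : ∀ t, f t = (x / 2) ^ (-ν) * F (t + c) := by
    intro t
    simp only [hf, hF]
    rw [neg_add, Real.exp_add, Real.exp_add, Real.exp_neg c, ec, Real.rpow_def_of_pos hx2, ← Real.exp_add, Real.cosh_eq]
    congr 1
    rw [← hc]
    field_simp
    ring
  have hfi : Integrable f := by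
    rw [show f = _ from funext e]
    exact (hFi.comp_add_right c).const_mul _
  have hfint : ∫ t, f t = (x / 2) ^ (-ν) * Lf ν (x ^ 2 / 4) := by
    rw [show f = _ from funext e, integral_const_mul, integral_add_right_eq_self F c]
    rfl
  have hfn : Integrable (fun t => f (-t)) := hfi.comp_neg
  have h1 : ∫ t in Set.Ioi 0, f (-t) = ∫ t in Set.Iic 0, f t := by
    rw [integral_comp_neg_Ioi, neg_zero]
  have h2 : besselK ν x = ∫ t in Set.Ioi 0, (1 / 2) * (f t + f (-t)) := by
    rw [besselK]
    congr 1; ext t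
    simp only [hf]
    rw [Real.cosh_neg, Real.cosh_eq (ν * t), sub_eq_add_neg, sub_eq_add_neg, Real.exp_add, Real.exp_add, mul_neg, neg_mul]
    ring
  rw [h2, integral_const_mul, integral_add hfi.integrableOn hfn.integrableOn, h1, add_comm,
    intervalIntegral.integral_Iic_add_Ioi hfi.integrableOn hfi.integrableOn, hfint]
  ring

lemma quad_bound {b p z : ℝ} (h : 0 ≤ z - b * p - p ^ 2) :
    2 * p ≤ -b + Real.sqrt (b ^ 2 + 4 * z) := by
  have : 2 * p + b ≤ Real.sqrt (b ^ 2 + 4 * z) := Real.le_sqrt_of_sq_le (by nlinarith)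
  linarith

lemma quad_bound_lt {b p z : ℝ} (h : 0 < z - b * p - p ^ 2) :
    2 * p < -b + Real.sqrt (b ^ 2 + 4 * z) := by
  have : 2 * p + b < Real.sqrt (b ^ 2 + 4 * z) := Real.lt_sqrt_of_sq_lt (by nlinarith)
  linarith

lemma main_aux (ν x : ℝ) (hν : -1 < ν) (hx : 0 < x) :
    besselI ν x * besselK ν x >
      1 / (1 + Real.sqrt (ν ^ 2 + x ^ 2) + Real.sqrt ((ν - 1) ^ 2 + x ^ 2)) := by
  have hx2 : 0 < x / 2 := by positivity
  set z := x ^ 2 / 4 with hz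
  have hz0 : 0 < z := by positivity
  have e : besselI ν x * besselK ν x = Gf ν z * Lf ν z / 2 := by
    rw [besselI_eq, besselK_eq ν x hx, Real.rpow_neg hx2.le]
    have := (Real.rpow_pos_of_pos hx2 ν).ne'
    rw [← hz]
    field_simp
  have hg := Gf_pos ν hν z hz0.le
  have hl := Lf_pos ν z hz0
  have w := wronskian ν hν z hz0
  have t := Gf_turan ν hν z hz0
  have r := Lf_rec ν z hz0
  have t' := Lf_turan (ν - 1) z hz0
  have r' := Lf_rec (ν - 1) z hz0
  rw [show ν - 1 + 1 = ν by ring] at t' r'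
  set g := Gf ν z
  set g' := Gf (ν + 1) z
  set L := Lf ν z
  have b1 : 2 * (z * g' / g) < -ν + Real.sqrt (ν ^ 2 + 4 * z) := by
    apply quad_bound_lt
    have : z - ν * (z * g' / g) - (z * g' / g) ^ 2 = z / g ^ 2 * (g ^ 2 - ν * g * g' - z * g' ^ 2) := by
      field_simp
    rw [this]; positivity
  have b2 : 2 * (z * Lf (ν - 1) z / L) ≤ -(ν - 1) + Real.sqrt ((ν - 1) ^ 2 + 4 * z) := by
    apply quad_bound
    have : z - (ν - 1) * (z * Lf (ν - 1) z / L) - (z * Lf (ν - 1) z / L) ^ 2 = z / L ^ 2 * (L * (L - (ν - 1) * Lf (ν - 1) z) - z * Lf (ν - 1) z ^ 2) := by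
      field_simp
    rw [this, ← r']
    have : 0 ≤ L * (z * Lf (ν - 1 - 1) z) - z * Lf (ν - 1) z ^ 2 := by nlinarith [t']
    positivity
  have h4 : 4 * z = x ^ 2 := by rw [hz]; ring
  rw [h4] at b1 b2
  rw [e, gt_iff_lt, one_div_lt (by positivity) (by positivity)]
  have : 1 / (g * L / 2) = 2 * (z * g' / g) + 2 * ν + 2 * (z * Lf (ν - 1) z / L) := by
    rw [r]
    field_simp
    linear_combination -w
  rw [this]
  linarith

lemma besselI_neg_one (x : ℝ) (hx : 0 < x) : besselI (-1) x = besselI 1 x := by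
  have hx2 : 0 < x / 2 := by positivity
  rw [besselI_eq, besselI_eq]
  set z := x ^ 2 / 4 with hz
  have key : ∀ k : ℕ, z ^ (k + 1) / ((Nat.factorial (k + 1) : ℝ) * Real.Gamma ((k + 1 : ℕ) + (-1) + 1))
      = z * (z ^ k / ((Nat.factorial k : ℝ) * Real.Gamma (k + 1 + 1))) := by
    intro k
    have hk : (0:ℝ) < (k:ℝ) + 1 := by positivity
    rw [Real.Gamma_add_one hk.ne', Nat.factorial_succ]
    push_cast
    rw [show (k:ℝ) + 1 + -1 + 1 = k + 1 by ring]
    have := (Real.Gamma_pos_of_pos hk).ne'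
    field_simp
    ring
  have hG : Gf (-1) z = z * Gf 1 z := by
    rw [Gf, Summable.tsum_eq_zero_add]
    · simp only [key]
      rw [tsum_mul_left, Gf]
      simp
    · rw [← summable_nat_add_iff 1]
      simp only [key]
      exact (Gf_summable 1 (by norm_num) z).mul_left z
  rw [hG, Real.rpow_one, Real.rpow_neg_one, hz]
  field_simp
  ring

lemma besselK_neg_one (x : ℝ) : besselK (-1) x = besselK 1 x := by
  unfold besselK
  simp only [neg_mul, one_mul, Real.cosh_neg]

theorem besselI_mul_besselK_lower_bound (ν x : ℝ) (hν : -1 ≤ ν) (hx : 0 < x) :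
    besselI ν x * besselK ν x >
      1 / (1 + Real.sqrt (ν ^ 2 + x ^ 2) + Real.sqrt ((ν - 1) ^ 2 + x ^ 2)) := by
  rcases hν.lt_or_eq with h | h
  · exact main_aux ν x h hx
  · subst h
    rw [besselI_neg_one x hx, besselK_neg_one]
    refine lt_of_le_of_lt ?_ (main_aux 1 x (by norm_num) hx)
    have : Real.sqrt ((1 - 1) ^ 2 + x ^ 2) ≤ Real.sqrt ((-1 - 1) ^ 2 + x ^ 2) :=
      Real.sqrt_le_sqrt (by norm_num)
    apply one_div_le_one_div_of_le (by positivity)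
    rw [show ((-1:ℝ)) ^ 2 = 1 ^ 2 by norm_num]
    linarith
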